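/- (Theorem 1, deletion attack.) Fix T ∈ ℕ. For i = 1,…,T, let m_i be a finite set with n_i = |m_i|, let r_i ∈ ℕ with r_i ≤ n_i, and let k_i be a sub-sampling size with k_i ≤ n_i − r_i. Let Ω_X be the set of tuples (z_1,…,z_T) where each z_i is a k_i-element subset of m_i, and let X be uniformly distributed on Ω_X. Let g be an arbitrary function from tuples to a label type, A a label, and p_A, p_B ∈ [0,1] reals with Pr(g(X) = A) ≥ p_A and Pr(g(X) = l) ≤ p_B for every label l ≠ A. Define δ_l = p_A − ⌊p_A·∏_{i=1}^T C(n_i,k_i)⌋/∏_{i=1}^T C(n_i,k_i) and δ_u = ⌈p_B·∏_{i=1}^T C(n_i,k_i)⌉/∏_{i=1}^T C(n_i,k_i) − p_B, and set e_i = n_i − r_i and n'_i = n_i − r_i. Suppose (∏_{i=1}^T C(n_i,k_i)/∏_{i=1}^T C(n'_i,k_i))·(p_A − δ_l − 1 + ∏_{i=1}^T C(e_i,k_i)/∏_{i=1}^T C(n_i,k_i)) ≥ (∏_{i=1}^T C(n_i,k_i)/∏_{i=1}^T C(n'_i,k_i))·(p_B + δ_u) + 1 − ∏_{i=1}^T C(e_i,k_i)/∏_{i=1}^T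 C(n'_i,k_i). Then for every choice of finite sets m'_1,…,m'_T with m'_i ⊆ m_i and |m'_i| ≥ n_i − r_i for all i, letting Y be uniformly distributed on the set Ω_Y of tuples (z_1,…,z_T) with each z_i a k_i-element subset of m'_i, we have Pr(g(Y) = A) ≥ Pr(g(Y) = l) for every label l ≠ A. -/

import Mathlib

/-- The probability of an event `P` under the uniform distribution on a finite set `Ω`:
`Pr(P) = |{x ∈ Ω : P x}| / |Ω|`. -/
noncomputable def uniformProb {β : Type*} (Ω : Finset β) (P : β → Prop) [DecidablePred P] : ℝ :=
  ((Ω.filter P).card : ℝ) / (Ω.card : ℝ)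

/-- Restricting a finite set to a subset removes at most as many elements satisfying `P` as it
removes in total. -/
theorem card_filter_add_card_le_of_subset {β : Type*} {s t : Finset β} (h : s ⊆ t)
    (P : β → Prop) [DecidablePred P] :
    (t.filter P).card + s.card ≤ (s.filter P).card + t.card := by
  have hs := Finset.card_filter_add_card_filter_not (s := s) P
  have ht := Finset.card_filter_add_card_filter_not (s := t) P
  have hle := Finset.card_le_card (Finset.filter_subset_filter (fun x => ¬ P x) h)
  omega

theorem card_piFinset_powersetCard {ι : Type*} [DecidableEq ι] [Fintype ι] {α : ι → Type*}
    (m : ∀ i, Finset (α i)) (k : ι → ℕ) :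
    ((Fintype.piFinset fun i => (m i).powersetCard (k i)).card : ℝ)
      = ∏ i, ((m i).card.choose (k i) : ℝ) := by
  simp [Fintype.card_piFinset]

/-- The paper's Theorem 1 for deletion attacks: a deletion attack of size `(r 1, …, r T)`
removes at most `r i` basic elements from modality `m i`, so the perturbed modality `m' i`
satisfies `m' i ⊆ m i` and `|m' i| ≥ n i − r i`.  With `e i = n i − r i` and
`n' i = n i − r i`, if `Pr(g(X) = A) ≥ p_A`, `Pr(g(X) = l) ≤ p_B` for all `l ≠ A`, and the
certification condition holds, then for every such perturbation,
`Pr(g(Y) = A) ≥ Pr(g(Y) = l)` for every `l ≠ A`. -/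
theorem multimodal_certification_deletion {T : ℕ} {α : Fin T → Type*}
    [∀ i, DecidableEq (α i)] {L : Type*} [DecidableEq L]
    (m : ∀ i, Finset (α i)) (n r e n' k : Fin T → ℕ)
    (hn : ∀ i, (m i).card = n i) (hr : ∀ i, r i ≤ n i) (hk : ∀ i, k i ≤ n i - r i)
    (he : ∀ i, e i = n i - r i) (hn' : ∀ i, n' i = n i - r i)
    (g : (∀ i, Finset (α i)) → L) (A : L) (pA pB : ℝ)
    (hpA0 : 0 ≤ pA) (hpA1 : pA ≤ 1) (hpB0 : 0 ≤ pB) (hpB1 : pB ≤ 1)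
    (hA : uniformProb (Fintype.piFinset fun i => (m i).powersetCard (k i))
        (fun z => g z = A) ≥ pA)
    (hB : ∀ l : L, l ≠ A →
      uniformProb (Fintype.piFinset fun i => (m i).powersetCard (k i))
        (fun z => g z = l) ≤ pB)
    (δl δu : ℝ)
    (hδl : δl = pA - (⌊pA * ∏ i, ((n i).choose (k i) : ℝ)⌋ : ℝ) / ∏ i, ((n i).choose (k i) : ℝ))
    (hδu : δu = (⌈pB * ∏ i, ((n i).choose (k i) : ℝ)⌉ : ℝ) / (∏ i, ((n i).choose (k i) : ℝ)) - pB)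
    (hcond : ((∏ i, ((n i).choose (k i) : ℝ)) / (∏ i, ((n' i).choose (k i) : ℝ)))
          * (pA - δl - 1 + (∏ i, ((e i).choose (k i) : ℝ)) / (∏ i, ((n i).choose (k i) : ℝ)))
      ≥ ((∏ i, ((n i).choose (k i) : ℝ)) / (∏ i, ((n' i).choose (k i) : ℝ))) * (pB + δu)
          + 1 - (∏ i, ((e i).choose (k i) : ℝ)) / (∏ i, ((n' i).choose (k i) : ℝ))) :
    ∀ m' : ∀ i, Finset (α i),
      (∀ i, m' i ⊆ m i) → (∀ i, (m' i).card ≥ n i - r i) →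
      ∀ l : L, l ≠ A →
        uniformProb (Fintype.piFinset fun i => (m' i).powersetCard (k i)) (fun z => g z = A)
          ≥ uniformProb (Fintype.piFinset fun i => (m' i).powersetCard (k i)) (fun z => g z = l) := by
  intro m' hsub hcard l hl
  obtain rfl : e = fun i => n i - r i := funext he
  obtain rfl : n' = fun i => n i - r i := funext hn'
  set X := Fintype.piFinset fun i => (m i).powersetCard (k i) with hX
  set Y := Fintype.piFinset fun i => (m' i).powersetCard (k i) with hY
  have hYX : Y ⊆ X := Fintype.piFinset_subset _ _ fun i => Finset.powersetCard_mono (hsub i)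
  have hXcard : (X.card : ℝ) = ∏ i, ((n i).choose (k i) : ℝ) := by
    simp only [hX, card_piFinset_powersetCard, hn]
  rw [← hXcard] at hδl hδu hcond
  set E : ℝ := ∏ i, ((n i - r i).choose (k i) : ℝ) with hE
  have hE0 : 0 < E := Finset.prod_pos fun i _ => Nat.cast_pos.2 (Nat.choose_pos (hk i))
  have hEY : E ≤ Y.card := by
    rw [hY, card_piFinset_powersetCard]
    exact Finset.prod_le_prod (fun i _ => Nat.cast_nonneg _)
      fun i _ => Nat.cast_le.2 (Nat.choose_le_choose _ (hcard i))
  have hX0 : (0 : ℝ) < X.card :=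
    hE0.trans_le (hEY.trans (Nat.cast_le.2 (Finset.card_le_card hYX)))
  have hAX : (⌊pA * (X.card : ℝ)⌋ : ℝ) ≤ (X.filter fun z => g z = A).card :=
    (Int.floor_le _).trans ((le_div_iff₀ hX0).1 hA)
  have hlX : ((X.filter fun z => g z = l).card : ℝ) ≤ (⌈pB * (X.card : ℝ)⌉ : ℝ) :=
    ((div_le_iff₀ hX0).1 (hB l hl)).trans (Int.le_ceil _)
  have hlY : ((Y.filter fun z => g z = l).card : ℝ) ≤ (X.filter fun z => g z = l).card :=
    Nat.cast_le.2 (Finset.card_le_card (Finset.filter_subset_filter _ hYX))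
  have hAY : ((X.filter fun z => g z = A).card : ℝ) + Y.card
      ≤ (Y.filter fun z => g z = A).card + X.card := by
    exact_mod_cast card_filter_add_card_le_of_subset hYX fun z => g z = A
  have hgap : (⌈pB * (X.card : ℝ)⌉ : ℝ) + X.card ≤ ⌊pA * (X.card : ℝ)⌋ + E := by
    generalize (⌊pA * (X.card : ℝ)⌋ : ℝ) = a at *
    generalize (⌈pB * (X.card : ℝ)⌉ : ℝ) = b at *
    have hleft : (X.card / E) * (pA - δl - 1 + E / X.card) = (a - X.card + E) / E := by
      rw [hδl]; field_simp; ring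
    have hright : (X.card / E) * (pB + δu) + 1 - E / E = b / E := by
      rw [hδu]; field_simp; ring
    rw [hleft, hright] at hcond
    linarith [(div_le_div_iff_of_pos_right hE0).1 hcond]
  exact div_le_div_of_nonneg_right (by linarith) (Nat.cast_nonneg _)
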